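/- arXiv:2111.12468 — 2 statements merged into one kernel-verified Lean document; each statement's English description precedes it below -/
import Mathlib

section
/- Let h and h′ be horofunctions of ((0,∞)ⁿ, d_T) given by h(x) = max( max_{i∈I}(−α_i − log x_i), max_{j∈J}(−α_j + log x_j) ) and h′(x) = max( max_{i∈I′}(−α′_i − log x_i), max_{j∈J′}(−α′_j + log x_j) ), where I, J ⊆ {1,…,n} are disjoint with I ∪ J nonempty, I′, J′ ⊆ {1,…,n} are disjoint with I′ ∪ J′ nonempty, α ≥ 0 with min_{k∈I∪J} α_k = 0, and α′ ≥ 0 with min_{k∈I′∪J′} α′_k = 0. Then δ(h,h′) < ∞ if and only if I = I′ and J = J′, and in that case δ(h,h′) = max( max_{i∈I}(α_i − α′_i), max_{j∈J}(α_j − α′_j) ) + max( max_{i∈I}(α′_i − α_i), max_{j∈J}(α′_j − α_j) ), where a maximum over an empty index set is omitted. -/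
open Filter Topology

/-- The internal function `h_y(z) = d(z,y) - d(b,y)` of a point `y`, for the
distance `d` with basepoint `b`. -/
noncomputable def intFn {M : Type*} (d : M → M → ℝ) (b y : M) : M → ℝ :=
  fun z => d z y - d b y

/-- The horofunction compactification of `(M,d)` with basepoint `b`: the closure of the
set of internal functions in the space of all real functions on `M` with the topology of
pointwise convergence. -/
def horoCpt {M : Type*} (d : M → M → ℝ) (b : M) : Set (M → ℝ) :=
  closure (Set.range (intFn d b))

/-- The detour cost `H(h,h')`. -/
noncomputable def detourCost {M : Type*} (d : M → M → ℝ) (b : M) (h h' : M → ℝ) : EReal :=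
  ⨆ W ∈ 𝓝[horoCpt d b] h, ⨅ x ∈ {x : M | intFn d b x ∈ W}, ((d b x + h' x : ℝ) : EReal)

/-- The detour distance `δ(h,h') = H(h,h') + H(h',h)`. -/
noncomputable def detourDist {M : Type*} (d : M → M → ℝ) (b : M) (h h' : M → ℝ) : EReal :=
  detourCost d b h h' + detourCost d b h' h

/-- The open positive orthant `(0,∞)ⁿ`. -/
def Pos (n : ℕ) : Type := {x : Fin n → ℝ // ∀ i, 0 < x i}

/-- The Thompson distance on the open positive orthant. -/
noncomputable def dT (n : ℕ) (x y : Pos n) : ℝ :=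
  ⨆ i, |Real.log (x.1 i) - Real.log (y.1 i)|

/-- The basepoint `u = (1,…,1)` of the positive orthant. -/
def uPos (n : ℕ) : Pos n := ⟨fun _ => 1, fun _ => one_pos⟩

theorem sub_le_detourCost {M : Type*} {d : M → M → ℝ} {b : M} {h h' : M → ℝ}
    (hlip : ∀ x z, h' z ≤ h' x + d z x) (z : M) :
    ((h' z - h z : ℝ) : EReal) ≤ detourCost d b h h' := by
  refine EReal.ge_of_forall_gt_iff_ge.1 fun c hc => ?_
  rw [EReal.coe_lt_coe_iff] at hc
  have hW : {f : M → ℝ | f z < h' z - c} ∈ 𝓝[horoCpt d b] h :=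
    mem_nhdsWithin_of_mem_nhds <|
      (isOpen_lt (continuous_apply z) continuous_const).mem_nhds (by
        change h z < h' z - c
        linarith)
  refine le_trans ?_ (le_iSup₂ (f := fun W (_ : W ∈ 𝓝[horoCpt d b] h) =>
    ⨅ x ∈ {x : M | intFn d b x ∈ W}, ((d b x + h' x : ℝ) : EReal)) _ hW)
  refine le_iInf₂ fun x hx => ?_
  have hx : d z x - d b x < h' z - c := hx
  rw [EReal.coe_le_coe_iff]
  linarith [hlip x z]

theorem detourCost_le {M ι : Type*} {d : M → M → ℝ} {b : M} {h h' : M → ℝ} {l : Filter ι}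
    [l.NeBot] {y : ι → M} {c : ℝ} (hy : Tendsto (fun t => intFn d b (y t)) l (𝓝 h))
    (hc : ∀ᶠ t in l, d b (y t) + h' (y t) ≤ c) : detourCost d b h h' ≤ c := by
  refine iSup₂_le fun W hW => ?_
  have hy' : Tendsto (fun t => intFn d b (y t)) l (𝓝[horoCpt d b] h) :=
    tendsto_nhdsWithin_iff.2 ⟨hy, .of_forall fun t => subset_closure ⟨y t, rfl⟩⟩
  obtain ⟨t, ht, htc⟩ := ((hy'.eventually_mem hW).and hc).exists
  exact (iInf₂_le (y t) ht).trans (EReal.coe_le_coe_iff.2 htc)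

section Orthant

variable {n : ℕ}

/-- The function `max (max_{i ∈ I} (-α i - log x i)) (max_{j ∈ J} (-α j + log x j))`. -/
noncomputable def horoFn (I J : Finset (Fin n)) (hne : (I ∪ J).Nonempty) (α : Fin n → ℝ) :
    Pos n → ℝ := fun x => (I ∪ J).sup' hne fun k =>
  if k ∈ I then -α k - Real.log (x.1 k) else -α k + Real.log (x.1 k)

/-- The point of the positive orthant with logarithm `v`. -/
noncomputable def expPos (v : Fin n → ℝ) : Pos n :=
  ⟨fun k => Real.exp (v k), fun _ => Real.exp_pos _⟩

@[simp]
theorem log_expPos (v : Fin n → ℝ) (k : Fin n) : Real.log ((expPos v).1 k) = v k :=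
  Real.log_exp _

@[simp]
theorem log_uPos (k : Fin n) : Real.log ((uPos n).1 k) = 0 := Real.log_one

theorem abs_log_sub_log_le_dT (x y : Pos n) (k : Fin n) :
    |Real.log (x.1 k) - Real.log (y.1 k)| ≤ dT n x y :=
  le_ciSup (f := fun i => |Real.log (x.1 i) - Real.log (y.1 i)|) (Set.finite_range _).bddAbove k

variable {I J I' J' : Finset (Fin n)} {hne : (I ∪ J).Nonempty} {hne' : (I' ∪ J').Nonempty}
  {α α' : Fin n → ℝ}

theorem le_horoFn_left (hne : (I ∪ J).Nonempty) (α : Fin n → ℝ) (x : Pos n) {k : Fin n}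
    (hk : k ∈ I) : -α k - Real.log (x.1 k) ≤ horoFn I J hne α x :=
  (Finset.le_sup'_iff _).2 ⟨k, Finset.mem_union_left J hk, by simp [hk]⟩

theorem le_horoFn_right (hd : Disjoint I J) (hne : (I ∪ J).Nonempty) (α : Fin n → ℝ) (x : Pos n)
    {k : Fin n} (hk : k ∈ J) : -α k + Real.log (x.1 k) ≤ horoFn I J hne α x :=
  (Finset.le_sup'_iff _).2
    ⟨k, Finset.mem_union_right I hk, by simp [Finset.disjoint_right.1 hd hk]⟩

theorem horoFn_le {x : Pos n} {c : ℝ} (hI : ∀ k ∈ I, -α k - Real.log (x.1 k) ≤ c)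
    (hJ : ∀ k ∈ J, -α k + Real.log (x.1 k) ≤ c) : horoFn I J hne α x ≤ c := by
  refine Finset.sup'_le _ _ fun k hk => ?_
  split_ifs with h
  · exact hI k h
  · exact hJ k ((Finset.mem_union.1 hk).resolve_left h)

theorem horoFn_le_add_dT (hd : Disjoint I J) (x z : Pos n) :
    horoFn I J hne α z ≤ horoFn I J hne α x + dT n z x := by
  refine horoFn_le (fun k hk => ?_) fun k hk => ?_ <;>
    have h := abs_le.1 (abs_log_sub_log_le_dT z x k)
  · linarith [le_horoFn_left hne α x hk]
  · linarith [le_horoFn_right hd hne α x hk]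

theorem horoFn_uPos (hmin : (I ∪ J).inf' hne α = 0) : horoFn I J hne α (uPos n) = 0 := by
  have hα : ∀ k ∈ I ∪ J, 0 ≤ α k := fun k hk => hmin ▸ Finset.inf'_le α hk
  obtain ⟨k, hk, hk0⟩ := Finset.exists_mem_eq_inf' hne α
  refine le_antisymm (horoFn_le (fun i hi => ?_) fun i hi => ?_) ?_
  · simpa using hα i (Finset.mem_union_left _ hi)
  · simpa using hα i (Finset.mem_union_right _ hi)
  · exact (Finset.le_sup'_iff _).2 ⟨k, hk, by simp [← hk0, hmin]⟩

/-- A path in the positive orthant whose internal functions converge to `horoFn I J hne α`. -/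
noncomputable def horoPath (I J : Finset (Fin n)) (α : Fin n → ℝ) (t : ℝ) : Pos n :=
  expPos fun k => if k ∈ I then t - α k else if k ∈ J then α k - t else 0

theorem log_horoPath_left (t : ℝ) {k : Fin n} (hk : k ∈ I) :
    Real.log ((horoPath I J α t).1 k) = t - α k := by
  simp [horoPath, hk]

theorem log_horoPath_right (hd : Disjoint I J) (t : ℝ) {k : Fin n} (hk : k ∈ J) :
    Real.log ((horoPath I J α t).1 k) = α k - t := by
  simp [horoPath, hk, Finset.disjoint_right.1 hd hk]

theorem eventually_dT_horoPath (hd : Disjoint I J) (hne : (I ∪ J).Nonempty) (α : Fin n → ℝ)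
    (z : Pos n) :
    ∀ᶠ t in atTop, dT n z (horoPath I J α t) = t + horoFn I J hne α z := by
  have hev : ∀ᶠ t : ℝ in atTop, ∀ k,
      |α k| + |Real.log (z.1 k)| + |horoFn I J hne α z| ≤ t :=
    eventually_all.2 fun k => eventually_ge_atTop _
  filter_upwards [hev] with t ht
  have : Nonempty (Fin n) := ⟨hne.choose⟩
  refine le_antisymm (ciSup_le fun k => ?_) ?_
  · have h1 := abs_le.1 (le_refl |α k|)
    have h2 := abs_le.1 (le_refl |Real.log (z.1 k)|)
    have h3 := abs_le.1 (le_refl |horoFn I J hne α z|)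
    have h4 := ht k
    by_cases hI : k ∈ I
    · rw [log_horoPath_left t hI, abs_le]
      have := le_horoFn_left hne α z hI
      constructor <;> linarith [abs_nonneg (horoFn I J hne α z)]
    by_cases hJ : k ∈ J
    · rw [log_horoPath_right hd t hJ, abs_le]
      have := le_horoFn_right hd hne α z hJ
      constructor <;> linarith [abs_nonneg (horoFn I J hne α z)]
    · have : Real.log ((horoPath I J α t).1 k) = 0 := by simp [horoPath, hI, hJ]
      rw [this, sub_zero]
      linarith [abs_nonneg (α k)]
  · suffices h : horoFn I J hne α z ≤ dT n z (horoPath I J α t) - t by linarith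
    refine horoFn_le (fun k hk => ?_) fun k hk => ?_ <;>
      have h := abs_le.1 (abs_log_sub_log_le_dT z (horoPath I J α t) k)
    · rw [log_horoPath_left t hk] at h
      linarith
    · rw [log_horoPath_right hd t hk] at h
      linarith

theorem tendsto_intFn_horoPath (hd : Disjoint I J) (hmin : (I ∪ J).inf' hne α = 0) :
    Tendsto (fun t => intFn (dT n) (uPos n) (horoPath I J α t)) atTop
      (𝓝 (horoFn I J hne α)) := by
  refine tendsto_pi_nhds.2 fun z => tendsto_const_nhds.congr' ?_
  filter_upwards [eventually_dT_horoPath hd hne α z,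
    eventually_dT_horoPath hd hne α (uPos n)] with t h1 h2
  rw [intFn, h1, h2, horoFn_uPos hmin]
  ring

theorem detourCost_horoFn (hd : Disjoint I J) (hmin : (I ∪ J).inf' hne α = 0) :
    detourCost (dT n) (uPos n) (horoFn I J hne α) (horoFn I J hne α') =
      (((I ∪ J).sup' hne fun k => α k - α' k : ℝ) : EReal) := by
  apply le_antisymm
  · refine detourCost_le (tendsto_intFn_horoPath hd hmin) ?_
    filter_upwards [eventually_dT_horoPath hd hne α (uPos n)] with t ht
    rw [ht, horoFn_uPos hmin]
    suffices h : horoFn I J hne α' (horoPath I J α t) ≤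
        ((I ∪ J).sup' hne fun k => α k - α' k) - t by linarith
    refine horoFn_le (fun k hk => ?_) fun k hk => ?_
    · rw [log_horoPath_left t hk]
      linarith [Finset.le_sup' (fun k => α k - α' k) (Finset.mem_union_left J hk)]
    · rw [log_horoPath_right hd t hk]
      linarith [Finset.le_sup' (fun k => α k - α' k) (Finset.mem_union_right I hk)]
  · refine le_trans ?_ (sub_le_detourCost (horoFn_le_add_dT hd) (horoPath I J α 0))
    rw [EReal.coe_le_coe_iff]
    have h0 : horoFn I J hne α (horoPath I J α 0) ≤ 0 := by
      refine horoFn_le (fun k hk => ?_) fun k hk => ?_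
      · simp [log_horoPath_left 0 hk]
      · simp [log_horoPath_right hd 0 hk]
    refine Finset.sup'_le _ _ fun k hk => ?_
    rcases Finset.mem_union.1 hk with hk | hk
    · have := le_horoFn_left hne α' (horoPath I J α 0) hk
      rw [log_horoPath_left 0 hk] at this
      linarith
    · have := le_horoFn_right hd hne α' (horoPath I J α 0) hk
      rw [log_horoPath_right hd 0 hk] at this
      linarith

theorem bot_lt_detourCost_horoFn (hd' : Disjoint I' J') (h : Pos n → ℝ) :
    ⊥ < detourCost (dT n) (uPos n) h (horoFn I' J' hne' α') :=
  (EReal.bot_lt_coe _).trans_le (sub_le_detourCost (horoFn_le_add_dT hd') (uPos n))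

theorem detourCost_horoFn_eq_top (hd' : Disjoint I' J') (hα : ∀ k ∈ I ∪ J, 0 ≤ α k)
    (hsub : ¬(I' ⊆ I ∧ J' ⊆ J)) :
    detourCost (dT n) (uPos n) (horoFn I J hne α) (horoFn I' J' hne' α') = ⊤ := by
  have hI : ∀ i ∈ I, 0 ≤ α i := fun i hi => hα i (Finset.mem_union_left _ hi)
  have hJ : ∀ i ∈ J, 0 ≤ α i := fun i hi => hα i (Finset.mem_union_right _ hi)
  refine EReal.eq_top_iff_forall_lt _ |>.2 fun c => ?_
  suffices h : ∃ z, horoFn I J hne α z ≤ 0 ∧ c < horoFn I' J' hne' α' z by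
    obtain ⟨z, hz, hcz⟩ := h
    refine lt_of_lt_of_le ?_ (sub_le_detourCost (horoFn_le_add_dT hd') z)
    rw [EReal.coe_lt_coe_iff]
    linarith
  rw [not_and_or, Finset.not_subset, Finset.not_subset] at hsub
  rcases hsub with ⟨k, hk, hkn⟩ | ⟨k, hk, hkn⟩
  · refine ⟨expPos (Pi.single k (-(|c| + |α' k| + 1))), horoFn_le (fun i hi => ?_)
      fun i hi => ?_, ?_⟩
    · have : i ≠ k := fun h => hkn (h ▸ hi)
      simpa [this] using hI i hi
    · have := hJ i hi
      rcases eq_or_ne i k with rfl | h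
      · simp only [log_expPos, Pi.single_eq_same]
        linarith [abs_nonneg c, abs_nonneg (α' i)]
      · simpa [h] using this
    · refine lt_of_lt_of_le ?_ (le_horoFn_left hne' α' _ hk)
      simp only [log_expPos, Pi.single_eq_same]
      linarith [le_abs_self c, le_abs_self (α' k)]
  · refine ⟨expPos (Pi.single k (|c| + |α' k| + 1)), horoFn_le (fun i hi => ?_)
      fun i hi => ?_, ?_⟩
    · have := hI i hi
      rcases eq_or_ne i k with rfl | h
      · simp only [log_expPos, Pi.single_eq_same]
        linarith [abs_nonneg c, abs_nonneg (α' i)]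
      · simpa [h] using this
    · have : i ≠ k := fun h => hkn (h ▸ hi)
      simpa [this] using hJ i hi
    · refine lt_of_lt_of_le ?_ (le_horoFn_right hd' hne' α' _ hk)
      simp only [log_expPos, Pi.single_eq_same]
      linarith [le_abs_self c, le_abs_self (α' k)]

end Orthant

theorem stmt8 (n : ℕ) (hn : 1 ≤ n) (I J I' J' : Finset (Fin n))
    (hd : Disjoint I J) (hd' : Disjoint I' J')
    (hne : (I ∪ J).Nonempty) (hne' : (I' ∪ J').Nonempty)
    (α α' : Fin n → ℝ)
    (hα : ∀ k ∈ I ∪ J, 0 ≤ α k) (hmin : (I ∪ J).inf' hne α = 0)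
    (hα' : ∀ k ∈ I' ∪ J', 0 ≤ α' k) (hmin' : (I' ∪ J').inf' hne' α' = 0)
    (h h' : Pos n → ℝ)
    (hh : ∀ x, h x = (I ∪ J).sup' hne fun k =>
        if k ∈ I then -α k - Real.log (x.1 k) else -α k + Real.log (x.1 k))
    (hh' : ∀ x, h' x = (I' ∪ J').sup' hne' fun k =>
        if k ∈ I' then -α' k - Real.log (x.1 k) else -α' k + Real.log (x.1 k)) :
    (detourDist (dT n) (uPos n) h h' < ⊤ ↔ I = I' ∧ J = J') ∧
    (I = I' ∧ J = J' →
      detourDist (dT n) (uPos n) h h' =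
        ((((I ∪ J).sup' hne fun k => α k - α' k) +
          ((I ∪ J).sup' hne fun k => α' k - α k) : ℝ) : EReal)) := by
  obtain rfl : h = horoFn I J hne α := funext hh
  obtain rfl : h' = horoFn I' J' hne' α' := funext hh'
  have hval : I = I' ∧ J = J' →
      detourDist (dT n) (uPos n) (horoFn I J hne α) (horoFn I' J' hne' α') =
        ((((I ∪ J).sup' hne fun k => α k - α' k) +
          ((I ∪ J).sup' hne fun k => α' k - α k) : ℝ) : EReal) := by
    rintro ⟨rfl, rfl⟩
    rw [detourDist, detourCost_horoFn hd hmin, detourCost_horoFn hd hmin', EReal.coe_add]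
  refine ⟨⟨fun hlt => ?_, fun heq => hval heq ▸ EReal.coe_lt_top _⟩, hval⟩
  by_contra hne_sets
  refine hlt.ne ?_
  by_cases hsub : I' ⊆ I ∧ J' ⊆ J
  · have hsub' : ¬(I ⊆ I' ∧ J ⊆ J') := fun hs =>
      hne_sets ⟨hs.1.antisymm hsub.1, hs.2.antisymm hsub.2⟩
    rw [detourDist, detourCost_horoFn_eq_top hd hα' hsub',
      EReal.add_top_of_ne_bot (bot_lt_detourCost_horoFn hd' _).ne']
  · rw [detourDist, detourCost_horoFn_eq_top hd' hα hsub,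
      EReal.top_add_of_ne_bot (bot_lt_detourCost_horoFn hd _).ne']
end

section
/- Let A and B be n×n positive definite complex Hermitian matrices. Then max{ log inf{β > 0 : A ≤ βB}, log inf{β > 0 : B ≤ βA} } = ‖ log(B^{-1/2} A B^{-1/2}) ‖, where ≤ is the Loewner order and ‖·‖ is the operator norm (equivalently, the maximum of |λ| over the eigenvalues λ of log(B^{-1/2} A B^{-1/2})). In other words, the Thompson distance d_T(A,B) = max{ log M(A/B), log M(B/A) } satisfies d_T(A,B) = ‖log(B^{-1/2} A B^{-1/2})‖. -/
open Matrix
open scoped ComplexOrder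

/-- The Loewner order on complex matrices: `A ≤ B` iff `B - A` is positive semidefinite. -/
def loe {n : ℕ} (A B : Matrix (Fin n) (Fin n) ℂ) : Prop := (B - A).PosSemidef

/-- The operator norm of a Hermitian matrix: the largest absolute value of an eigenvalue. -/
noncomputable def hermNorm {n : ℕ} {A : Matrix (Fin n) (Fin n) ℂ} (hA : A.IsHermitian) : ℝ :=
  ⨆ i, |hA.eigenvalues i|

/-- `B^{-1/2}` of a positive definite matrix `B`, via the continuous functional calculus. -/
noncomputable def invSqrt {n : ℕ} {B : Matrix (Fin n) (Fin n) ℂ} (hB : B.PosDef) :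
    Matrix (Fin n) (Fin n) ℂ :=
  hB.1.cfc fun x => (Real.sqrt x)⁻¹

lemma cfc_isHermitian {n : ℕ} {A : Matrix (Fin n) (Fin n) ℂ} (hA : A.IsHermitian) (f : ℝ → ℝ) :
    (hA.cfc f).IsHermitian := by
  rw [← hA.cfc_eq]
  exact cfc_predicate f A

lemma conj_isHermitian {n : ℕ} {A B : Matrix (Fin n) (Fin n) ℂ}
    (hA : A.IsHermitian) (hB : B.PosDef) :
    (invSqrt hB * A * invSqrt hB).IsHermitian := by
  have hC : (invSqrt hB).IsHermitian := cfc_isHermitian hB.1 _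
  unfold Matrix.IsHermitian at *
  rw [Matrix.conjTranspose_mul, Matrix.conjTranspose_mul, hA, hC, Matrix.mul_assoc]

/-- The set of positive definite `n × n` complex (Hermitian) matrices. -/
def PDn (n : ℕ) : Type := {A : Matrix (Fin n) (Fin n) ℂ // A.PosDef}

/-- The Thompson distance `d_T(A,B) = ‖log (B^{-1/2} A B^{-1/2})‖` on positive definite
matrices. -/
noncomputable def dTM (n : ℕ) (X Y : PDn n) : ℝ :=
  hermNorm (cfc_isHermitian (conj_isHermitian X.2.1 Y.2) Real.log)

/-- The basepoint: the identity matrix. -/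
noncomputable def uPD (n : ℕ) : PDn n := ⟨1, Matrix.PosDef.one⟩

lemma invSqrt_isHermitian {n : ℕ} {B : Matrix (Fin n) (Fin n) ℂ} (hB : B.PosDef) :
    (invSqrt hB).IsHermitian :=
  cfc_isHermitian hB.1 _

lemma invSqrt_mul_mul_invSqrt {n : ℕ} {B : Matrix (Fin n) (Fin n) ℂ} (hB : B.PosDef) :
    invSqrt hB * B * invSqrt hB = 1 := by
  have hs : IsSelfAdjoint B := hB.1
  have hc (f : ℝ → ℝ) : ContinuousOn f (spectrum ℝ B) := B.finite_real_spectrum.continuousOn f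
  rw [invSqrt, ← hB.1.cfc_eq]
  nth_rw 2 [← cfc_id ℝ B]
  rw [← cfc_mul _ _ B (hc _) (hc _), ← cfc_mul _ _ B (hc _) (hc _), ← cfc_one ℝ B]
  refine cfc_congr fun x hx => ?_
  obtain ⟨i, rfl⟩ := hB.1.spectrum_real_eq_range_eigenvalues ▸ hx
  have hpos := hB.eigenvalues_pos i
  have hne := (Real.sqrt_pos.2 hpos).ne'
  simp only [id, Pi.one_apply]
  field_simp
  exact (Real.sq_sqrt hpos.le).symm

lemma isUnit_invSqrt {n : ℕ} {B : Matrix (Fin n) (Fin n) ℂ} (hB : B.PosDef) :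
    IsUnit (invSqrt hB) := by
  have h := invSqrt_mul_mul_invSqrt hB
  rw [Matrix.mul_assoc] at h
  exact IsUnit.of_mul_eq_one _ h

/-- The Loewner order is invariant under conjugation by `B^{-1/2}`. -/
lemma loe_invSqrt_conj_iff {n : ℕ} {B : Matrix (Fin n) (Fin n) ℂ} (hB : B.PosDef)
    (X Y : Matrix (Fin n) (Fin n) ℂ) :
    loe (invSqrt hB * X * invSqrt hB) (invSqrt hB * Y * invSqrt hB) ↔ loe X Y := by
  have h := Matrix.IsUnit.posSemidef_star_left_conjugate_iff (x := Y - X) (isUnit_invSqrt hB)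
  rw [Matrix.star_eq_conjTranspose, (invSqrt_isHermitian hB).eq] at h
  rw [loe, loe, ← h, Matrix.mul_sub, Matrix.sub_mul]

lemma posDef_invSqrt_conj {n : ℕ} {A B : Matrix (Fin n) (Fin n) ℂ} (hA : A.PosDef)
    (hB : B.PosDef) : (invSqrt hB * A * invSqrt hB).PosDef := by
  have h := Matrix.IsUnit.posDef_star_left_conjugate_iff (x := A) (isUnit_invSqrt hB)
  rw [Matrix.star_eq_conjTranspose, (invSqrt_isHermitian hB).eq] at h
  exact h.2 hA

open scoped MatrixOrder in
lemma loe_smul_one_iff {n : ℕ} {C : Matrix (Fin n) (Fin n) ℂ} (hC : C.IsHermitian) (β : ℝ) :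
    loe C (β • 1) ↔ ∀ i, hC.eigenvalues i ≤ β := by
  have h := le_algebraMap_iff_spectrum_le (R := ℝ) (r := β) (a := C) hC
  rw [hC.spectrum_real_eq_range_eigenvalues, Set.forall_mem_range, Matrix.le_iff,
    Algebra.algebraMap_eq_smul_one] at h
  exact h

open scoped MatrixOrder in
lemma smul_one_loe_iff {n : ℕ} {C : Matrix (Fin n) (Fin n) ℂ} (hC : C.IsHermitian) (β : ℝ) :
    loe (β • 1) C ↔ ∀ i, β ≤ hC.eigenvalues i := by
  have h := algebraMap_le_iff_le_spectrum (R := ℝ) (r := β) (a := C) hC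
  rw [hC.spectrum_real_eq_range_eigenvalues, Set.forall_mem_range, Matrix.le_iff,
    Algebra.algebraMap_eq_smul_one] at h
  exact h

lemma loe_smul_iff_inv_smul_loe {n : ℕ} {X Y : Matrix (Fin n) (Fin n) ℂ} {β : ℝ} (hβ : 0 < β) :
    loe X (β • Y) ↔ loe (β⁻¹ • X) Y := by
  unfold loe
  constructor <;> intro h
  · simpa [smul_sub, smul_smul, hβ.ne'] using h.smul (inv_pos.2 hβ).le
  · simpa [smul_sub, smul_smul, hβ.ne'] using h.smul hβ.le

/-- `A ≤ β B` iff `β` bounds the eigenvalues of `B^{-1/2} A B^{-1/2}` from above. -/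
lemma loe_smul_iff_eigenvalues_le {n : ℕ} {A B : Matrix (Fin n) (Fin n) ℂ} (hA : A.IsHermitian)
    (hB : B.PosDef) (β : ℝ) :
    loe A (β • B) ↔ ∀ i, (conj_isHermitian hA hB).eigenvalues i ≤ β := by
  rw [← loe_invSqrt_conj_iff hB, Matrix.mul_smul, Matrix.smul_mul, invSqrt_mul_mul_invSqrt hB]
  exact loe_smul_one_iff _ _

/-- `B ≤ β A` iff `β⁻¹` bounds the eigenvalues of `B^{-1/2} A B^{-1/2}` from below. -/
lemma loe_smul_iff_le_eigenvalues {n : ℕ} {A B : Matrix (Fin n) (Fin n) ℂ} (hA : A.IsHermitian)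
    (hB : B.PosDef) {β : ℝ} (hβ : 0 < β) :
    loe B (β • A) ↔ ∀ i, β⁻¹ ≤ (conj_isHermitian hA hB).eigenvalues i := by
  rw [loe_smul_iff_inv_smul_loe hβ, ← loe_invSqrt_conj_iff hB, Matrix.mul_smul, Matrix.smul_mul,
    invSqrt_mul_mul_invSqrt hB]
  exact smul_one_loe_iff _ _

lemma range_eigenvalues_cfc {n : ℕ} {C : Matrix (Fin n) (Fin n) ℂ} (hC : C.IsHermitian)
    (f : ℝ → ℝ) :
    Set.range (cfc_isHermitian hC f).eigenvalues = Set.range fun i => f (hC.eigenvalues i) := by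
  rw [← (cfc_isHermitian hC f).spectrum_real_eq_range_eigenvalues, ← hC.cfc_eq,
    cfc_map_spectrum f C hC.isSelfAdjoint (C.finite_real_spectrum.continuousOn f),
    hC.spectrum_real_eq_range_eigenvalues, ← Set.range_comp]
  rfl

lemma hermNorm_cfc {n : ℕ} {C : Matrix (Fin n) (Fin n) ℂ} (hC : C.IsHermitian) (f : ℝ → ℝ) :
    hermNorm (cfc_isHermitian hC f) = ⨆ i, |f (hC.eigenvalues i)| := by
  have h := congrArg (fun s => sSup (abs '' s)) (range_eigenvalues_cfc hC f)
  simp only [← Set.range_comp] at h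
  exact h

theorem stmt16 (n : ℕ) (hn : 1 ≤ n) (A B : Matrix (Fin n) (Fin n) ℂ)
    (hA : A.PosDef) (hB : B.PosDef) :
    max (Real.log (sInf {β : ℝ | 0 < β ∧ loe A (β • B)}))
        (Real.log (sInf {β : ℝ | 0 < β ∧ loe B (β • A)})) =
      hermNorm (cfc_isHermitian (conj_isHermitian hA.1 hB) Real.log) := by
  have : Nonempty (Fin n) := ⟨⟨0, hn⟩⟩
  rw [hermNorm_cfc]
  have hpos : ∀ i, 0 < (conj_isHermitian hA.1 hB).eigenvalues i :=
    (posDef_invSqrt_conj hA hB).eigenvalues_pos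
  have hAB := loe_smul_iff_eigenvalues_le hA.1 hB
  have hBA := fun β : ℝ => loe_smul_iff_le_eigenvalues (β := β) hA.1 hB
  generalize (conj_isHermitian hA.1 hB).eigenvalues = l at hpos hAB hBA ⊢
  obtain ⟨i, hi⟩ := Finite.exists_max l
  obtain ⟨j, hj⟩ := Finite.exists_min l
  have hleast₁ : IsLeast {β : ℝ | 0 < β ∧ loe A (β • B)} (l i) :=
    ⟨⟨hpos i, (hAB _).2 hi⟩, fun β hβ => (hAB β).1 hβ.2 i⟩
  have hleast₂ : IsLeast {β : ℝ | 0 < β ∧ loe B (β • A)} (l j)⁻¹ :=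
    ⟨⟨inv_pos.2 (hpos j), (hBA _ (inv_pos.2 (hpos j))).2 (by simpa using hj)⟩,
      fun β hβ => inv_le_of_inv_le₀ hβ.1 ((hBA β hβ.1).1 hβ.2 j)⟩
  rw [hleast₁.csInf_eq, hleast₂.csInf_eq, Real.log_inv]
  have hbdd : BddAbove (Set.range fun k => |Real.log (l k)|) := Set.finite_range _ |>.bddAbove
  refine le_antisymm (max_le ?_ ?_) (ciSup_le fun k => abs_le'.2 ⟨?_, ?_⟩)
  · exact (le_abs_self _).trans (le_ciSup hbdd i)
  · exact (neg_le_abs _).trans (le_ciSup hbdd j)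
  · exact (Real.log_le_log (hpos k) (hi k)).trans (le_max_left _ _)
  · exact (neg_le_neg (Real.log_le_log (hpos j) (hj k))).trans (le_max_right _ _)
end
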